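/- arXiv:1901.08550 — 2 statements merged into one kernel-verified Lean document; each statement's English description precedes it below -/
import Mathlib

section
/- Fix d ≥ 1 and m ≥ 1. For each divisor s of m, the map sending a word of length s with period s and no cyclic repetitions to its (m/s)-fold concatenation is a bijection onto the set of words of length m with period s and no cyclic repetitions. Consequently A_d(m) = Σ_{s | m} t̃cyc_d(s), the sum being over all divisors s of m. -/
/-- A word `w` of length `m` in `d` letters (a function `Fin m → Fin d`) has
*no cyclic repetitions* if `w i ≠ w (i+1)` for `1 ≤ i ≤ m-1` and `w m ≠ w 1`,
i.e. adjacent letters differ cyclically (indices taken mod `m`). -/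
def NoCycRep {d m : ℕ} (w : Fin m → Fin d) : Prop :=
  ∀ i j : Fin m, ((i : ℕ) + 1) % m = (j : ℕ) → w i ≠ w j

/-- `w` is invariant under cyclic rotation of the indices by `s`. -/
def RotInvBy {d m : ℕ} (s : ℕ) (w : Fin m → Fin d) : Prop :=
  ∀ i j : Fin m, ((i : ℕ) + s) % m = (j : ℕ) → w j = w i

/-- The *period* of a word: the least `s ≥ 1` such that `w` is invariant under
rotation by `s`. -/
noncomputable def wordPeriod {d m : ℕ} (w : Fin m → Fin d) : ℕ :=
  sInf {s : ℕ | 0 < s ∧ RotInvBy s w}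

/-- The `m`-periodic extension to `ℕ` of a word of length `m`. -/
def periodicExtension {d m : ℕ} (hm : 0 < m) (w : Fin m → Fin d) (n : ℕ) : Fin d :=
  w ⟨n % m, Nat.mod_lt _ hm⟩

lemma periodicExtension_val {d m : ℕ} (hm : 0 < m) (w : Fin m → Fin d) (i : Fin m) :
    periodicExtension hm w i = w i :=
  congrArg w (Fin.ext (Nat.mod_eq_of_lt i.isLt))

lemma periodicExtension_periodic {d m : ℕ} (hm : 0 < m) (w : Fin m → Fin d) :
    Function.Periodic (periodicExtension hm w) m := fun n => by
  simp [periodicExtension]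

lemma rotInvBy_iff_periodic {d m : ℕ} (hm : 0 < m) (s : ℕ) (w : Fin m → Fin d) :
    RotInvBy s w ↔ Function.Periodic (periodicExtension hm w) s := by
  constructor
  · intro h n
    exact h _ _ (by simp)
  · intro h i j hij
    rw [← periodicExtension_val hm w i, ← h i]
    exact congrArg w (Fin.ext hij.symm)

lemma noCycRep_iff_forall_ne {d m : ℕ} (hm : 0 < m) (w : Fin m → Fin d) :
    NoCycRep w ↔ ∀ n, periodicExtension hm w n ≠ periodicExtension hm w (n + 1) := by
  constructor
  · intro h n
    exact h _ _ (by simp)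
  · intro h i j hij
    rw [← periodicExtension_val hm w i, show w j = periodicExtension hm w (i + 1) from
      congrArg w (Fin.ext hij.symm)]
    exact h i

lemma wordPeriod_eq_sInf_periodic {d m : ℕ} (hm : 0 < m) (w : Fin m → Fin d) :
    wordPeriod w = sInf {s : ℕ | 0 < s ∧ Function.Periodic (periodicExtension hm w) s} := by
  simp only [wordPeriod, rotInvBy_iff_periodic hm]

lemma wordPeriod_pos_and_periodic {d m : ℕ} (hm : 0 < m) (w : Fin m → Fin d) :
    0 < wordPeriod w ∧ Function.Periodic (periodicExtension hm w) (wordPeriod w) := by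
  rw [wordPeriod_eq_sInf_periodic hm]
  exact Nat.sInf_mem (s := {s : ℕ | 0 < s ∧ Function.Periodic (periodicExtension hm w) s})
    ⟨m, hm, periodicExtension_periodic hm w⟩

lemma wordPeriod_dvd {d m : ℕ} (hm : 0 < m) (w : Fin m → Fin d) : wordPeriod w ∣ m := by
  obtain ⟨hpos, hper⟩ := wordPeriod_pos_and_periodic hm w
  by_contra hdvd
  have hmod : Function.Periodic (periodicExtension hm w) (m % wordPeriod w) := fun n => by
    have h := (hper.nat_mul (m / wordPeriod w)) (n + m % wordPeriod w)
    rw [Nat.cast_id, add_assoc, mul_comm, Nat.mod_add_div, periodicExtension_periodic hm w n] at h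
    exact h.symm
  have hle : wordPeriod w ≤ m % wordPeriod w := by
    conv_lhs => rw [wordPeriod_eq_sInf_periodic hm]
    exact Nat.sInf_le ⟨Nat.emod_pos_of_not_dvd hdvd, hmod⟩
  exact absurd (Nat.mod_lt m hpos) (not_lt.mpr hle)

/-- The `(m / s)`-fold concatenation of a word of length `s`, for `s ∣ m`. -/
def concatWord {d s : ℕ} (m : ℕ) (hs : 0 < s) (w : Fin s → Fin d) (i : Fin m) : Fin d :=
  w ⟨(i : ℕ) % s, Nat.mod_lt _ hs⟩

lemma periodicExtension_concatWord {d m s : ℕ} (hm : 0 < m) (hs : 0 < s) (hsm : s ∣ m)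
    (w : Fin s → Fin d) :
    periodicExtension hm (concatWord m hs w) = periodicExtension hs w := by
  funext n
  simp [periodicExtension, concatWord, Nat.mod_mod_of_dvd n hsm]

lemma wordPeriod_concatWord {d m s : ℕ} (hm : 0 < m) (hs : 0 < s) (hsm : s ∣ m)
    (w : Fin s → Fin d) : wordPeriod (concatWord m hs w) = wordPeriod w := by
  rw [wordPeriod_eq_sInf_periodic hm, wordPeriod_eq_sInf_periodic hs,
    periodicExtension_concatWord hm hs hsm]

lemma noCycRep_concatWord {d m s : ℕ} (hm : 0 < m) (hs : 0 < s) (hsm : s ∣ m)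
    (w : Fin s → Fin d) : NoCycRep (concatWord m hs w) ↔ NoCycRep w := by
  rw [noCycRep_iff_forall_ne hm, noCycRep_iff_forall_ne hs, periodicExtension_concatWord hm hs hsm]

lemma concatWord_injective {d m s : ℕ} (hm : 0 < m) (hs : 0 < s) (hsm : s ∣ m) :
    Function.Injective (concatWord (d := d) m hs) := fun w w' h => by
  funext i
  rw [← periodicExtension_val hs w, ← periodicExtension_val hs w',
    ← periodicExtension_concatWord hm hs hsm w, h, periodicExtension_concatWord hm hs hsm]

lemma exists_concatWord_eq {d m s : ℕ} (hm : 0 < m) (hs : 0 < s) (v : Fin m → Fin d)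
    (hv : Function.Periodic (periodicExtension hm v) s) :
    ∃ w : Fin s → Fin d, concatWord m hs w = v := by
  refine ⟨fun i => periodicExtension hm v i, funext fun i => ?_⟩
  exact (hv.map_mod_nat i).trans (periodicExtension_val hm v i)

lemma bijOn_concatWord {d m s : ℕ} (hm : 0 < m) (hs : 0 < s) (hsm : s ∣ m) :
    Set.BijOn (concatWord m hs)
      {w : Fin s → Fin d | wordPeriod w = s ∧ NoCycRep w}
      {v : Fin m → Fin d | wordPeriod v = s ∧ NoCycRep v} := by
  refine ⟨fun w hw => ?_, (concatWord_injective hm hs hsm).injOn, fun v hv => ?_⟩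
  · rwa [Set.mem_ofPred_eq, wordPeriod_concatWord hm hs hsm, noCycRep_concatWord hm hs hsm]
  · have hper := (wordPeriod_pos_and_periodic hm v).2
    rw [hv.1] at hper
    obtain ⟨w, rfl⟩ := exists_concatWord_eq hm hs v hper
    rw [Set.mem_ofPred_eq, wordPeriod_concatWord hm hs hsm, noCycRep_concatWord hm hs hsm] at hv
    exact ⟨w, hv, rfl⟩

lemma card_noCycRep_eq_sum_wordPeriod (d : ℕ) {m : ℕ} (hm : 0 < m) :
    Nat.card {w : Fin m → Fin d // NoCycRep w}
      = ∑ s ∈ m.divisors, Nat.card {v : Fin m → Fin d // wordPeriod v = s ∧ NoCycRep v} := by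
  classical
  simp only [Nat.card_eq_fintype_card, Fintype.card_subtype]
  rw [Finset.card_eq_sum_card_fiberwise (f := wordPeriod) (t := m.divisors)
    fun w _ => Nat.mem_divisors.mpr ⟨wordPeriod_dvd hm w, hm.ne'⟩]
  simp only [Finset.filter_filter, and_comm]

/-- Fix `d ≥ 1` and `m ≥ 1`.  For each divisor `s` of `m`, the
`(m/s)`-fold concatenation map is a bijection from the words of length `s`,
period `s`, with no cyclic repetitions, onto the words of length `m`, period
`s`, with no cyclic repetitions.  Consequently `A_d(m) = Σ_{s ∣ m} t̃cyc_d(s)`. -/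
theorem stmt5 (d m : ℕ) (hd : 1 ≤ d) (hm : 1 ≤ m) :
    (∀ (s : ℕ), s ∣ m → ∀ hs : 0 < s,
      Set.BijOn
        (fun (w : Fin s → Fin d) (i : Fin m) => w ⟨(i : ℕ) % s, Nat.mod_lt _ hs⟩)
        {w : Fin s → Fin d | wordPeriod w = s ∧ NoCycRep w}
        {v : Fin m → Fin d | wordPeriod v = s ∧ NoCycRep v})
    ∧ Nat.card {w : Fin m → Fin d // NoCycRep w}
        = ∑ s ∈ m.divisors,
            Nat.card {w : Fin s → Fin d // wordPeriod w = s ∧ NoCycRep w} := by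
  refine ⟨fun s hsm hs => bijOn_concatWord hm hs hsm, ?_⟩
  rw [card_noCycRep_eq_sum_wordPeriod d hm]
  refine Finset.sum_congr rfl fun s hs => ?_
  exact (Nat.card_congr (bijOn_concatWord hm (Nat.pos_of_mem_divisors hs)
    (Nat.dvd_of_mem_divisors hs)).equiv).symm
end

section
/- For all integers d ≥ 1 and s ≥ 1, s·cyc_d(s) = Σ_{j | s} μ(s/j)·((d−1)^j + (−1)^j (d−1)) as an identity of integers, where μ is the Möbius function and the sum is over all divisors j of s. -/
/-- Cyclic rotation of a word by `t` places. -/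
def rotWord {d m : ℕ} (t : ℕ) (w : Fin m → Fin d) : Fin m → Fin d :=
  fun i => w ⟨((i : ℕ) + t) % m, Nat.mod_lt _ i.pos⟩

open Function

section Dynamics

variable {α : Type*} {f : α → α}

theorem range_iterate_apply_of_mem_periodicPts {x : α} (hx : x ∈ periodicPts f) (k : ℕ) :
    (Set.range fun t : ℕ => f^[t] (f^[k] x)) = Set.range fun t : ℕ => f^[t] x := by
  obtain ⟨n, hn, hp⟩ := hx
  ext y
  constructor
  · rintro ⟨t, rfl⟩
    exact ⟨t + k, iterate_add_apply f t k x⟩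
  · rintro ⟨t, rfl⟩
    refine ⟨t + (n * k - k), ?_⟩
    have hk : k ≤ n * k := Nat.le_mul_of_pos_left k hn
    have hadd : t + (n * k - k) + k = t + n * k := by omega
    change f^[t + (n * k - k)] (f^[k] x) = f^[t] x
    rw [← iterate_add_apply, hadd, iterate_add_apply, (hp.mul_const k).eq]

/-- The points of exact period `s` in an invariant set split into orbits of size `s`. -/
theorem mul_card_orbits_eq_card_minimalPeriod {p : α → Prop} (hp : ∀ x, p x → p (f x))
    {s : ℕ} (hs : 0 < s) :
    s * Nat.card {O : Set α // ∃ x, minimalPeriod f x = s ∧ p x ∧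
        O = Set.range fun t : ℕ => f^[t] x} =
      Nat.card {x // minimalPeriod f x = s ∧ p x} := by
  have hper : ∀ {x}, minimalPeriod f x = s → x ∈ periodicPts f := fun h =>
    minimalPeriod_pos_iff_mem_periodicPts.1 (h ▸ hs)
  have hiter : ∀ x, p x → ∀ t, p (f^[t] x) := fun x hx t => by
    induction t with
    | zero => exact hx
    | succ t ih => rw [iterate_succ_apply']; exact hp _ ih
  rw [mul_comm, ← Nat.card_fin s, ← Nat.card_prod, Nat.card_fin s]
  refine Nat.card_eq_of_bijective (fun q => ⟨f^[q.2] q.1.2.choose,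
    (minimalPeriod_apply_iterate (hper q.1.2.choose_spec.1) _).trans q.1.2.choose_spec.1,
    hiter _ q.1.2.choose_spec.2.1 _⟩) ⟨?_, ?_⟩
  · rintro ⟨O, t⟩ ⟨O', t'⟩ h
    have h' : f^[t] O.2.choose = f^[t'] O'.2.choose := congrArg Subtype.val h
    have hO : O = O' := by
      apply Subtype.ext
      rw [O.2.choose_spec.2.2, O'.2.choose_spec.2.2,
        ← range_iterate_apply_of_mem_periodicPts (hper O.2.choose_spec.1) t, h',
        range_iterate_apply_of_mem_periodicPts (hper O'.2.choose_spec.1) t']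
    subst hO
    have ht : (t : ℕ) = t' := iterate_injOn_Iio_minimalPeriod
      (by simp [O.2.choose_spec.1]) (by simp [O.2.choose_spec.1]) h'
    rw [Fin.ext ht]
  · rintro ⟨x, hx, hpx⟩
    have hO : ∃ y, minimalPeriod f y = s ∧ p y ∧
        (Set.range fun t : ℕ => f^[t] x) = Set.range fun t : ℕ => f^[t] y := ⟨x, hx, hpx, rfl⟩
    have hmem : x ∈ Set.range fun t : ℕ => f^[t] hO.choose :=
      hO.choose_spec.2.2 ▸ ⟨0, rfl⟩
    obtain ⟨t, ht⟩ := hmem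
    refine ⟨⟨⟨_, hO⟩, ⟨t % s, Nat.mod_lt _ hs⟩⟩, Subtype.ext ?_⟩
    change f^[t % s] hO.choose = x
    have hmod := iterate_mod_minimalPeriod_eq (f := f) (x := hO.choose) (n := t)
    rw [hO.choose_spec.1] at hmod
    exact hmod.trans ht

theorem card_isPeriodicPt_eq_sum_card_minimalPeriod {p : α → Prop} {n : ℕ} (hn : 0 < n)
    [Finite {x // IsPeriodicPt f n x ∧ p x}] :
    Nat.card {x // IsPeriodicPt f n x ∧ p x} =
      ∑ j ∈ n.divisors, Nat.card {x // minimalPeriod f x = j ∧ p x} := by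
  have hfin : {x | IsPeriodicPt f n x ∧ p x}.Finite := ‹Finite {x // IsPeriodicPt f n x ∧ p x}›
  have hmaps : ∀ x ∈ hfin.toFinset, minimalPeriod f x ∈ n.divisors := fun x hx => by
    rw [Set.Finite.mem_toFinset] at hx
    exact Nat.mem_divisors.2 ⟨hx.1.minimalPeriod_dvd, hn.ne'⟩
  classical
  rw [Nat.subtype_card hfin.toFinset (by simp), Finset.card_eq_sum_card_fiberwise hmaps]
  refine Finset.sum_congr rfl fun j hj => (Nat.subtype_card _ fun x => ?_).symm
  simp only [Finset.mem_filter, Set.Finite.mem_toFinset, Set.mem_ofPred_eq]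
  refine ⟨fun h => ⟨h.2, h.1.2⟩, fun h => ⟨⟨?_, h.2⟩, h.1⟩⟩
  exact isPeriodicPt_iff_minimalPeriod_dvd.2 (h.1 ▸ Nat.dvd_of_mem_divisors hj)

end Dynamics

section Rotation

variable {d m : ℕ}

theorem rotWord_zero (w : Fin m → Fin d) : rotWord 0 w = w := by
  funext i
  simp [rotWord, Nat.mod_eq_of_lt i.isLt]

theorem rotWord_succ (t : ℕ) (w : Fin m → Fin d) :
    rotWord (t + 1) w = rotWord 1 (rotWord t w) := by
  funext i
  simp only [rotWord]
  congr 2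
  rw [Nat.mod_add_mod]
  congr 1
  ring

theorem iterate_rotWord (t : ℕ) (w : Fin m → Fin d) : (rotWord 1)^[t] w = rotWord t w := by
  induction t with
  | zero => exact (rotWord_zero w).symm
  | succ t ih => rw [iterate_succ_apply', ih, ← rotWord_succ]

theorem rotWord_self (w : Fin m → Fin d) : rotWord m w = w := by
  funext i
  simp [rotWord, Nat.mod_eq_of_lt i.isLt]

theorem rotInvBy_iff_isPeriodicPt {t : ℕ} {w : Fin m → Fin d} :
    RotInvBy t w ↔ IsPeriodicPt (rotWord 1) t w := by
  rw [IsPeriodicPt, IsFixedPt, iterate_rotWord]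
  constructor
  · exact fun h => funext fun i => h i _ rfl
  · intro h i j hij
    rw [← congrFun h i]
    exact congrArg w (Fin.ext hij.symm)

theorem wordPeriod_eq_minimalPeriod (hm : 0 < m) (w : Fin m → Fin d) :
    wordPeriod w = minimalPeriod (rotWord 1) w := by
  have hper : IsPeriodicPt (rotWord 1) m w :=
    rotInvBy_iff_isPeriodicPt.1 fun i j hij => by
      rw [← congrFun (rotWord_self w) i]
      exact congrArg w (Fin.ext hij.symm)
  apply le_antisymm
  · exact Nat.sInf_le ⟨hper.minimalPeriod_pos hm,
      rotInvBy_iff_isPeriodicPt.2 (isPeriodicPt_minimalPeriod _ _)⟩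
  · obtain ⟨hpos, hinv⟩ := Nat.sInf_mem (s := {s : ℕ | 0 < s ∧ RotInvBy s w})
      ⟨m, hm, rotInvBy_iff_isPeriodicPt.2 hper⟩
    exact (rotInvBy_iff_isPeriodicPt.1 hinv).minimalPeriod_le hpos

end Rotation

section Sequences

variable {d m : ℕ}

/-- The one-sided shift on sequences. -/
def shiftSeq (f : ℕ → Fin d) : ℕ → Fin d := fun i => f (i + 1)

theorem iterate_shiftSeq_apply (t : ℕ) (f : ℕ → Fin d) (i : ℕ) :
    shiftSeq^[t] f i = f (i + t) := by
  induction t generalizing i with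
  | zero => rfl
  | succ t ih =>
    rw [iterate_succ_apply', shiftSeq, ih]
    congr 1
    ring

/-- The periodic sequence obtained by repeating a word. -/
def repeatWord (hm : 0 < m) (w : Fin m → Fin d) : ℕ → Fin d :=
  fun i => w ⟨i % m, Nat.mod_lt _ hm⟩

theorem repeatWord_val (hm : 0 < m) (w : Fin m → Fin d) (i : Fin m) :
    repeatWord hm w i = w i :=
  congrArg w (Fin.ext (Nat.mod_eq_of_lt i.isLt))

theorem repeatWord_injective (hm : 0 < m) :
    Injective (repeatWord hm : (Fin m → Fin d) → ℕ → Fin d) := fun v w h => by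
  funext i
  rw [← repeatWord_val hm v, h, repeatWord_val]

theorem isPeriodicPt_repeatWord (hm : 0 < m) (w : Fin m → Fin d) :
    IsPeriodicPt shiftSeq m (repeatWord hm w) := by
  funext i
  simp [iterate_shiftSeq_apply, repeatWord]

theorem repeatWord_restrict (hm : 0 < m) {f : ℕ → Fin d} (hf : IsPeriodicPt shiftSeq m f) :
    repeatWord hm (fun i => f i) = f := by
  have hper : Function.Periodic f m := fun i => by
    rw [← iterate_shiftSeq_apply m f i, hf.eq]
  funext i
  exact hper.map_mod_nat i

theorem semiconj_repeatWord (hm : 0 < m) :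
    Semiconj (repeatWord hm : (Fin m → Fin d) → ℕ → Fin d) (rotWord 1) shiftSeq := fun w => by
  funext i
  simp [repeatWord, rotWord, shiftSeq]

theorem minimalPeriod_repeatWord (hm : 0 < m) (w : Fin m → Fin d) :
    minimalPeriod shiftSeq (repeatWord hm w) = minimalPeriod (rotWord 1) w := by
  refine minimalPeriod_eq_minimalPeriod_iff.2 fun n => ?_
  rw [IsPeriodicPt, IsFixedPt, ← (semiconj_repeatWord hm).iterate_right n w,
    (repeatWord_injective hm).eq_iff]
  rfl

theorem noCycRep_iff_repeatWord (hm : 0 < m) (w : Fin m → Fin d) :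
    NoCycRep w ↔ ∀ i, repeatWord hm w i ≠ repeatWord hm w (i + 1) := by
  constructor
  · exact fun h i => h _ _ (by simp)
  · intro h i j hij
    rw [← repeatWord_val hm w i]
    have := h i
    rwa [show repeatWord hm w (i + 1) = w j from congrArg w (Fin.ext hij)] at this

theorem noCycRep_rotWord_one {w : Fin m → Fin d} (hw : NoCycRep w) :
    NoCycRep (rotWord 1 w) := fun i j hij => by
  refine hw _ _ ?_
  simp [← hij]

/-- Words of length `m` without cyclic repetitions correspond to `m`-periodic sequences without
repetitions. -/
theorem card_noCycRep_eq_card_isPeriodicPt (hm : 0 < m) :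
    Nat.card {w : Fin m → Fin d // NoCycRep w} =
      Nat.card {f : ℕ → Fin d // IsPeriodicPt shiftSeq m f ∧ ∀ i, f i ≠ f (i + 1)} := by
  refine Nat.card_eq_of_bijective (fun w => ⟨repeatWord hm w.1, isPeriodicPt_repeatWord hm w.1,
    (noCycRep_iff_repeatWord hm w.1).1 w.2⟩) ⟨?_, ?_⟩
  · exact fun v w h => Subtype.ext (repeatWord_injective hm (congrArg Subtype.val h))
  · rintro ⟨f, hf, hrep⟩
    have hw := repeatWord_restrict hm hf
    exact ⟨⟨fun i => f i, (noCycRep_iff_repeatWord hm _).2 (hw.symm ▸ hrep)⟩, Subtype.ext hw⟩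

theorem finite_isPeriodicPt_shiftSeq (hm : 0 < m) (p : (ℕ → Fin d) → Prop) :
    Finite {f : ℕ → Fin d // IsPeriodicPt shiftSeq m f ∧ p f} :=
  Finite.of_injective (fun f => fun i : Fin m => f.1 i) fun f g h => Subtype.ext <| by
    rw [← repeatWord_restrict hm f.2.1, ← repeatWord_restrict hm g.2.1]
    exact congrArg (repeatWord hm) h

theorem card_minimalPeriod_rotWord_eq (hm : 0 < m) :
    Nat.card {w : Fin m → Fin d // minimalPeriod (rotWord 1) w = m ∧ NoCycRep w} =
      Nat.card {f : ℕ → Fin d // minimalPeriod shiftSeq f = m ∧ ∀ i, f i ≠ f (i + 1)} := by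
  refine Nat.card_eq_of_bijective (fun w => ⟨repeatWord hm w.1,
    (minimalPeriod_repeatWord hm w.1).trans w.2.1,
    (noCycRep_iff_repeatWord hm w.1).1 w.2.2⟩) ⟨?_, ?_⟩
  · exact fun v w h => Subtype.ext (repeatWord_injective hm (congrArg Subtype.val h))
  · rintro ⟨f, hf, hrep⟩
    have hw := repeatWord_restrict hm (hf ▸ isPeriodicPt_minimalPeriod shiftSeq f :
      IsPeriodicPt shiftSeq m f)
    exact ⟨⟨fun i => f i, by rw [← minimalPeriod_repeatWord hm, hw, hf],
      (noCycRep_iff_repeatWord hm _).2 (hw.symm ▸ hrep)⟩, Subtype.ext hw⟩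

end Sequences

section Counting

variable {d : ℕ}

/-- Consecutive letters of the word differ, with no condition relating the last and first. -/
def NoRep {n : ℕ} (w : Fin (n + 1) → Fin d) : Prop :=
  ∀ i : Fin n, w i.castSucc ≠ w i.succ

theorem noRep_cons {n : ℕ} (c : Fin d) (w : Fin (n + 1) → Fin d) :
    NoRep (Fin.cons c w : Fin (n + 2) → Fin d) ↔ c ≠ w 0 ∧ NoRep w := by
  simp only [NoRep, Fin.forall_fin_succ (n := n), Fin.castSucc_zero, Fin.cons_zero,
    Fin.cons_succ, ← Fin.succ_castSucc]

theorem noCycRep_iff_noRep {n : ℕ} (w : Fin (n + 1) → Fin d) :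
    NoCycRep w ↔ NoRep w ∧ w (Fin.last n) ≠ w 0 := by
  constructor
  · refine fun h => ⟨fun i => h _ _ ?_, h _ _ ?_⟩
    · simp
    · simp
  · rintro ⟨h, hlast⟩ i j hij
    induction i using Fin.lastCases with
    | last =>
      have : j = 0 := Fin.ext (by simpa using hij.symm)
      exact this ▸ hlast
    | cast i =>
      have : j = i.succ := Fin.ext <| by
        rw [← hij, Fin.val_castSucc, Nat.mod_eq_of_lt (by omega), Fin.val_succ]
      exact this ▸ h i

theorem card_noRep_succ (n : ℕ) :
    Nat.card {w : Fin (n + 2) → Fin d // NoRep w} =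
      Nat.card {w : Fin (n + 1) → Fin d // NoRep w} * (d - 1) := by
  let e : {w : Fin (n + 2) → Fin d // NoRep w} ≃
      Σ w : {w : Fin (n + 1) → Fin d // NoRep w}, {c : Fin d // c ≠ w.1 0} :=
    { toFun := fun w =>
        have h := (noRep_cons (w.1 0) (Fin.tail w.1)).1 ((Fin.cons_self_tail w.1).symm ▸ w.2)
        ⟨⟨Fin.tail w.1, h.2⟩, ⟨w.1 0, h.1⟩⟩
      invFun := fun q => ⟨Fin.cons q.2.1 q.1.1, (noRep_cons _ _).2 ⟨q.2.2, q.1.2⟩⟩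
      left_inv := fun w => Subtype.ext (Fin.cons_self_tail w.1)
      right_inv := fun q => rfl }
  have : Fintype {w : Fin (n + 1) → Fin d // NoRep w} := Fintype.ofFinite _
  rw [Nat.card_congr e, Nat.card_sigma]
  simp [Nat.card_eq_fintype_card, Fintype.card_subtype_compl]

theorem card_noRep (n : ℕ) :
    Nat.card {w : Fin (n + 1) → Fin d // NoRep w} = d * (d - 1) ^ n := by
  induction n with
  | zero =>
    rw [Nat.card_congr (Equiv.subtypeUnivEquiv (p := NoRep (d := d) (n := 0))
      fun _ i => i.elim0)]
    simp
  | succ n ih => rw [card_noRep_succ, ih, pow_succ, mul_assoc]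

/-- A word without linear repetitions either has no cyclic ones, or starts and ends with the same
letter, in which case deleting the first letter leaves a word without cyclic repetitions. -/
theorem card_noCycRep_add (n : ℕ) :
    Nat.card {w : Fin (n + 2) → Fin d // NoCycRep w} +
        Nat.card {w : Fin (n + 1) → Fin d // NoCycRep w} =
      Nat.card {w : Fin (n + 2) → Fin d // NoRep w} := by
  classical
  let p : {w : Fin (n + 2) → Fin d // NoRep w} → Prop := fun w => w.1 (Fin.last _) ≠ w.1 0
  rw [← Nat.card_congr (Equiv.sumCompl p), Nat.card_sum]
  congr 1
  · refine Nat.card_congr ((Equiv.subtypeEquivRight noCycRep_iff_noRep).trans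
      (Equiv.subtypeSubtypeEquivSubtypeInter NoRep
        fun w : Fin (n + 2) → Fin d => w (Fin.last _) ≠ w 0).symm)
  · refine Nat.card_eq_of_bijective (fun w => ⟨⟨Fin.cons (w.1 (Fin.last n)) w.1, ?_⟩, ?_⟩) ⟨?_, ?_⟩
    · exact (noRep_cons _ _).2 ((noCycRep_iff_noRep w.1).1 w.2).symm
    · simp [p, ← Fin.succ_last]
    · intro v w h
      have h' := congrArg (fun q => Fin.tail q.1.1) h
      exact Subtype.ext h'
    · rintro ⟨⟨w, hw⟩, hlast⟩
      have hlast' : Fin.tail w (Fin.last n) = w 0 := by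
        simpa [p, Fin.tail] using hlast
      have hw' := (noRep_cons (w 0) (Fin.tail w)).1 ((Fin.cons_self_tail w).symm ▸ hw)
      refine ⟨⟨Fin.tail w, (noCycRep_iff_noRep _).2 ⟨hw'.2, hlast' ▸ hw'.1⟩⟩,
        Subtype.ext (Subtype.ext ?_)⟩
      change Fin.cons (Fin.tail w (Fin.last n)) (Fin.tail w) = w
      rw [hlast', Fin.cons_self_tail]

theorem card_noCycRep (hd : 1 ≤ d) {m : ℕ} (hm : 0 < m) :
    (Nat.card {w : Fin m → Fin d // NoCycRep w} : ℤ) =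
      ((d : ℤ) - 1) ^ m + (-1) ^ m * ((d : ℤ) - 1) := by
  obtain ⟨n, rfl⟩ := Nat.exists_eq_succ_of_ne_zero hm.ne'
  clear hm
  induction n with
  | zero =>
    have : IsEmpty {w : Fin 1 → Fin d // NoCycRep w} := ⟨fun w => w.2 0 0 rfl rfl⟩
    simp
  | succ n ih =>
    have h := card_noCycRep_add (d := d) n
    rw [card_noRep] at h
    zify [hd] at h
    simp only [Nat.succ_eq_add_one] at ih ⊢
    rw [ih] at h
    linear_combination h

end Counting

/-- For `d ≥ 1` and `s ≥ 1`, the number `cyc_d(s)` of cyclic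
words (rotation orbits) in `d` letters of length `s`, period `s`, with no
cyclic repetitions satisfies
`s·cyc_d(s) = Σ_{j ∣ s} μ(s/j)·((d-1)^j + (-1)^j (d-1))` as integers, where `μ`
is the Möbius function. -/
theorem stmt8 (d s : ℕ) (hd : 1 ≤ d) (hs : 1 ≤ s) :
    (s : ℤ) *
        (Nat.card {O : Set (Fin s → Fin d) // ∃ w : Fin s → Fin d,
            wordPeriod w = s ∧ NoCycRep w ∧ O = Set.range fun t : ℕ => rotWord t w} : ℤ)
      = ∑ j ∈ s.divisors,
          ArithmeticFunction.moebius (s / j) *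
            (((d : ℤ) - 1) ^ j + (-1) ^ j * ((d : ℤ) - 1)) := by
  have horb : s * Nat.card {O : Set (Fin s → Fin d) // ∃ w : Fin s → Fin d,
      wordPeriod w = s ∧ NoCycRep w ∧ O = Set.range fun t : ℕ => rotWord t w} =
      Nat.card {f : ℕ → Fin d // minimalPeriod shiftSeq f = s ∧ ∀ i, f i ≠ f (i + 1)} := by
    rw [← card_minimalPeriod_rotWord_eq hs,
      ← mul_card_orbits_eq_card_minimalPeriod (p := NoCycRep)
        (fun _ => noCycRep_rotWord_one) hs]
    simp only [iterate_rotWord, wordPeriod_eq_minimalPeriod hs]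
  have hsum : ∀ n > 0, ∑ j ∈ n.divisors,
      (Nat.card {f : ℕ → Fin d // minimalPeriod shiftSeq f = j ∧ ∀ i, f i ≠ f (i + 1)} : ℤ) =
      ((d : ℤ) - 1) ^ n + (-1) ^ n * ((d : ℤ) - 1) := fun n hn => by
    have := finite_isPeriodicPt_shiftSeq (d := d) hn fun f => ∀ i, f i ≠ f (i + 1)
    rw [← card_noCycRep hd hn, card_noCycRep_eq_card_isPeriodicPt hn,
      card_isPeriodicPt_eq_sum_card_minimalPeriod hn, Nat.cast_sum]
  rw [← Nat.cast_mul, horb,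
    ← ArithmeticFunction.sum_eq_iff_sum_mul_moebius_eq.1 hsum s hs,
    ← Nat.sum_divisorsAntidiagonal' fun a b => ArithmeticFunction.moebius a *
      (((d : ℤ) - 1) ^ b + (-1) ^ b * ((d : ℤ) - 1))]
  simp
end
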